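/- Brandes' dependency recurrence: for a source s and any vertex v ≠ s, δ_{s⋆}(v) = Σ_{u : v ∈ P_s(u)} (σ_{sv}/σ_{su})·(1 + δ_{s⋆}(u)), where δ_{s⋆}(v) = Σ_{t≠s,v} σ_{st}(v)/σ_{st}. -/

import Mathlib

open scoped Classical

/-- A (simple) path from `s` to `t` in the directed graph with edge relation `E`. -/
def IsPathList {V : Type*} (E : V → V → Prop) (s t : V) (l : List V) : Prop :=
  l.head? = some s ∧ l.getLast? = some t ∧ l.Nodup ∧ l.Chain' E

/-- The length (total weight) of a path. -/
def pathCost {V : Type*} (W : V → V → ℝ) (l : List V) : ℝ :=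
  ((l.zip l.tail).map fun p => W p.1 p.2).sum

/-- Weighted shortest-path distance `d(s,t)`. -/
noncomputable def wdist {V : Type*} (E : V → V → Prop) (W : V → V → ℝ) (s t : V) : ℝ :=
  sInf (pathCost W '' {l | IsPathList E s t l})

/-- `σ_{st}`: the number of shortest `s`-`t` paths. -/
noncomputable def nsp {V : Type*} (E : V → V → Prop) (W : V → V → ℝ) (s t : V) : ℕ :=
  {l | IsPathList E s t l ∧ pathCost W l = wdist E W s t}.ncard

/-- `σ_{st}(v)`: the number of shortest `s`-`t` paths passing through `v`. -/
noncomputable def nspThrough {V : Type*} (E : V → V → Prop) (W : V → V → ℝ)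
    (v s t : V) : ℕ :=
  {l | IsPathList E s t l ∧ pathCost W l = wdist E W s t ∧ v ∈ l}.ncard

/-- Dependency score `δ_{s⋆}(v) = Σ_{t≠s,v} σ_{st}(v)/σ_{st}`. -/
noncomputable def dep {V : Type*} [Fintype V] [DecidableEq V] (E : V → V → Prop)
    (W : V → V → ℝ) (s v : V) : ℝ :=
  ∑ t ∈ (Finset.univ.erase s).erase v, (nspThrough E W v s t : ℝ) / (nsp E W s t : ℝ)

section Brandes
variable {V : Type*}

/-- Tight edges. -/
def TightE (E : V → V → Prop) (W : V → V → ℝ) (d : V → ℝ) (x y : V) : Prop :=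
  E x y ∧ d x + W x y = d y

/-- Tight paths. -/
def TP (R : V → V → Prop) (x t : V) : Set (List V) :=
  {l | l.head? = some x ∧ l.getLast? = some t ∧ l.IsChain R}

lemma pathCost_cons2 (W : V → V → ℝ) (x y : V) (l : List V) :
    pathCost W (x :: y :: l) = W x y + pathCost W (y :: l) := by
  simp [pathCost]

lemma pathCost_single (W : V → V → ℝ) (x : V) : pathCost W [x] = 0 := by
  simp [pathCost]

lemma pathCost_nonneg {E : V → V → Prop} {W : V → V → ℝ} (hW : ∀ u v, E u v → 0 < W u v)
    (l : List V) (h : l.IsChain E) : 0 ≤ pathCost W l := by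
  induction l with
  | nil => simp [pathCost]
  | cons x l ih =>
    cases l with
    | nil => simp [pathCost]
    | cons y l =>
      rw [List.isChain_cons_cons] at h
      rw [pathCost_cons2]
      have := ih h.2
      have := hW _ _ h.1
      linarith

lemma pathCost_append (W : V → V → ℝ) (l : List V) (x : V) (m : List V) :
    pathCost W (l ++ x :: m) = pathCost W (l ++ [x]) + pathCost W (x :: m) := by
  induction l with
  | nil => simp [pathCost]
  | cons y l ih =>
    cases l with
    | nil => simp [pathCost]
    | cons z l =>
      simp only [List.cons_append, pathCost_cons2] at ih ⊢
      linarith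

lemma potential {E : V → V → Prop} {W : V → V → ℝ} {d : V → ℝ}
    (hd : ∀ x y, E x y → d y ≤ d x + W x y) (t : V) (l : List V) (x : V)
    (hc : (x :: l).IsChain E) (ht : (x :: l).getLast? = some t) :
    d t ≤ d x + pathCost W (x :: l) ∧
      (d x + pathCost W (x :: l) = d t ↔ (x :: l).IsChain (TightE E W d)) := by
  induction l generalizing x with
  | nil => simp at ht; subst ht; simp [pathCost_single]
  | cons y l ih =>
    rw [List.isChain_cons_cons] at hc
    rw [List.getLast?_cons_cons] at ht
    obtain ⟨h1, h2⟩ := ih y hc.2 ht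
    have h3 := hd x y hc.1
    rw [pathCost_cons2, List.isChain_cons_cons, ← h2]
    refine ⟨by linarith, ?_, ?_⟩
    · intro h
      exact ⟨⟨hc.1, by linarith⟩, by linarith⟩
    · rintro ⟨⟨_, h4⟩, h5⟩
      linarith

lemma chain_lt {E : V → V → Prop} {W : V → V → ℝ} {d : V → ℝ}
    (hW : ∀ u v, E u v → 0 < W u v) {l : List V} (h : l.IsChain (TightE E W d)) :
    l.Pairwise (fun a b => d a < d b) := by
  have hch : l.IsChain (fun a b => d a < d b) := by
    refine h.imp ?_
    rintro a b ⟨h1, h2⟩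
    have := hW a b h1
    linarith
  have : IsTrans V (fun a b => d a < d b) := ⟨fun _ _ _ h1 h2 => lt_trans h1 h2⟩
  exact List.isChain_iff_pairwise.mp hch

lemma chain_nodup {E : V → V → Prop} {W : V → V → ℝ} {d : V → ℝ}
    (hW : ∀ u v, E u v → 0 < W u v) {l : List V} (h : l.IsChain (TightE E W d)) :
    l.Nodup :=
  (chain_lt hW h).imp (fun h => by rintro rfl; exact lt_irrefl _ h)

lemma wdist_le {E : V → V → Prop} {W : V → V → ℝ} (hW : ∀ u v, E u v → 0 < W u v)
    {s t : V} {l : List V} (h : IsPathList E s t l) : wdist E W s t ≤ pathCost W l := by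
  refine csInf_le ⟨0, ?_⟩ ⟨l, h, rfl⟩
  rintro _ ⟨m, hm, rfl⟩
  exact pathCost_nonneg hW m hm.2.2.2

lemma finite_nodup [Fintype V] : {l : List V | l.Nodup}.Finite := by
  refine (List.finite_length_le V (Fintype.card V)).subset ?_
  intro l hl
  exact hl.length_le_card

lemma wdist_attained [Fintype V] {E : V → V → Prop} {W : V → V → ℝ} 
    {s t : V} (h : ∃ l, IsPathList E s t l) :
    ∃ l, IsPathList E s t l ∧ pathCost W l = wdist E W s t := by
  have hf : {l | IsPathList E s t l}.Finite := finite_nodup.subset (fun l hl => hl.2.2.1)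
  have hn : (pathCost W '' {l | IsPathList E s t l}).Nonempty := Set.Nonempty.image _ h
  obtain ⟨l, hl, h⟩ := hn.csInf_mem (hf.image _)
  exact ⟨l, hl, h⟩

lemma wdist_self {E : V → V → Prop} {W : V → V → ℝ} (s : V) : wdist E W s s = 0 := by
  have : {l | IsPathList E s s l} = {[s]} := by
    ext l
    simp only [Set.mem_setOf_eq, Set.mem_singleton_iff]
    constructor
    · rintro ⟨h1, h2, h3, -⟩
      cases l with
      | nil => simp at h1
      | cons x l =>
        simp at h1
        subst h1
        cases l with
        | nil => rfl
        | cons y l =>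
          rw [List.getLast?_cons_cons] at h2
          have := List.mem_of_getLast? h2
          exact absurd this (List.nodup_cons.mp h3).1
    · rintro rfl
      exact ⟨rfl, rfl, by simp, List.isChain_singleton _⟩
  rw [wdist, this]
  simp [pathCost_single]

lemma wdist_edge [Fintype V] {E : V → V → Prop} {W : V → V → ℝ}
    (hW : ∀ u v, E u v → 0 < W u v) {s : V}
    (hreach : ∀ t, ∃ l, IsPathList E s t l) (x y : V) (hxy : E x y) :
    wdist E W s y ≤ wdist E W s x + W x y := by
  obtain ⟨l, ⟨h1, h2, h3, h4⟩, hl⟩ := wdist_attained (W := W) (hreach x)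
  have hw := hW x y hxy
  rw [← hl]
  by_cases hy : y ∈ l
  · obtain ⟨p, q, rfl⟩ := List.append_of_mem hy
    have hp : IsPathList E s y (p ++ [y]) := by
      have e : p ++ y :: q = (p ++ [y]) ++ q := by simp
      rw [e] at h1 h3 h4
      refine ⟨?_, by simp, h3.of_append_left, h4.left_of_append⟩
      rw [List.head?_append_of_ne_nil _ (by simp)] at h1
      exact h1
    have := wdist_le hW hp
    have h5 := pathCost_nonneg hW (y :: q) h4.right_of_append
    rw [pathCost_append]
    linarith
  · obtain ⟨p, rfl⟩ := List.getLast?_eq_some_iff.mp h2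
    have hp : IsPathList E s y (p ++ [x] ++ [y]) := by
      refine ⟨?_, by simp, ?_, ?_⟩
      · rw [List.head?_append_of_ne_nil _ (by simp)]
        exact h1
      · simp only [List.nodup_append, h3, true_and]
        refine ⟨by simp, ?_⟩
        intro a ha b hb
        simp at hb
        rintro rfl
        exact hy (hb ▸ ha)
      · refine List.IsChain.append h4 (by simp) ?_
        simp [hxy]
    have := wdist_le hW hp
    rw [List.append_assoc, List.singleton_append, pathCost_append, pathCost_cons2,
      pathCost_single] at this
    linarith

lemma shortest_iff [Fintype V] {E : V → V → Prop} {W : V → V → ℝ}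
    (hW : ∀ u v, E u v → 0 < W u v) {s : V}
    (hreach : ∀ t, ∃ l, IsPathList E s t l) (t : V) (l : List V) :
    (IsPathList E s t l ∧ pathCost W l = wdist E W s t) ↔
      l ∈ TP (TightE E W (wdist E W s)) s t := by
  have hd := wdist_edge hW hreach
  cases l with
  | nil => simp [IsPathList, TP]
  | cons x l =>
    constructor
    · rintro ⟨⟨h1, h2, h3, h4⟩, h5⟩
      refine ⟨h1, h2, ?_⟩
      rw [← (potential hd t l x h4 h2).2]
      simp at h1
      subst h1
      rw [wdist_self, zero_add, h5]
    · rintro ⟨h1, h2, h3⟩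
      have h4 : (x :: l).IsChain E := h3.imp (fun _ _ h => h.1)
      refine ⟨⟨h1, h2, chain_nodup hW h3, h4⟩, ?_⟩
      rw [← (potential hd t l x h4 h2).2] at h3
      simp at h1
      subst h1
      rw [wdist_self, zero_add] at h3
      exact h3

lemma TP_self {R : V → V → Prop} (hR : ∀ x t l, l ∈ TP R x t → l.Nodup) (u : V) :
    (TP R u u).ncard = 1 := by
  rw [Set.ncard_eq_one]
  refine ⟨[u], ?_⟩
  ext l
  simp only [Set.mem_singleton_iff]
  constructor
  · intro h
    have h3 := hR _ _ _ h
    obtain ⟨h1, h2, -⟩ := h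
    cases l with
    | nil => simp at h1
    | cons x l =>
      simp at h1
      subst h1
      cases l with
      | nil => rfl
      | cons y l =>
        rw [List.getLast?_cons_cons] at h2
        have := List.mem_of_getLast? h2
        exact absurd this (List.nodup_cons.mp h3).1
  · rintro rfl
    exact ⟨rfl, rfl, by simp⟩

lemma TP_through {R : V → V → Prop} (hR : ∀ x t l, l ∈ TP R x t → l.Nodup) (s u t : V) :
    {l | l ∈ TP R s t ∧ u ∈ l}.ncard = (TP R s u).ncard * (TP R u t).ncard := by
  rw [← Set.ncard_prod]
  have key : ∀ p b, p ∈ TP R s u → b ∈ TP R u t → ∃ q c, p = q ++ [u] ∧ b = u :: c ∧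
      u ∉ q ∧ u ∉ c := by
    intro p b hp hb
    have np := hR _ _ _ hp
    have nb := hR _ _ _ hb
    obtain ⟨q, rfl⟩ := List.getLast?_eq_some_iff.mp hp.2.1
    obtain ⟨c, rfl⟩ := List.head?_eq_some_iff.mp hb.1
    refine ⟨q, c, rfl, rfl, ?_, (List.nodup_cons.mp nb).1⟩
    intro h
    simp only [List.nodup_append] at np
    exact np.2.2 u h u (by simp) rfl
  have himg : {l | l ∈ TP R s t ∧ u ∈ l} =
      (fun z : List V × List V => z.1 ++ z.2.tail) '' (TP R s u ×ˢ TP R u t) := by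
    ext l
    constructor
    · rintro ⟨⟨h1, h2, h3⟩, hu⟩
      obtain ⟨p, q, rfl⟩ := List.append_of_mem hu
      refine ⟨(p ++ [u], u :: q), ⟨⟨?_, by simp, ?_⟩, rfl, ?_, h3.right_of_append⟩, by simp⟩
      · cases p <;> simpa using h1
      · have e : p ++ u :: q = (p ++ [u]) ++ q := by simp
        rw [e] at h3
        exact h3.left_of_append
      · rw [List.getLast?_append_of_ne_nil _ (by simp)] at h2
        exact h2
    · rintro ⟨⟨p, b⟩, ⟨hp, hb⟩, rfl⟩
      simp only at hp hb
      obtain ⟨q, c, rfl, rfl, -, -⟩ := key p b hp hb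
      simp only [List.tail_cons]
      refine ⟨⟨?_, ?_, ?_⟩, by simp⟩
      · rw [List.head?_append_of_ne_nil _ (by simp)]
        exact hp.1
      · rw [List.append_assoc, List.singleton_append,
          List.getLast?_append_of_ne_nil _ (by simp)]
        exact hb.2.1
      · rw [List.append_assoc, List.singleton_append, List.isChain_split]
        exact ⟨hp.2.2, hb.2.2⟩
  rw [himg]
  refine Set.ncard_image_of_injOn ?_
  rintro ⟨p, b⟩ ⟨hp, hb⟩ ⟨p', b'⟩ ⟨hp', hb'⟩ h
  simp only at hp hb hp' hb'
  obtain ⟨q, c, rfl, rfl, h1, h2⟩ := key p b hp hb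
  obtain ⟨q', c', rfl, rfl, h1', h2'⟩ := key p' b' hp' hb'
  simp only [List.tail_cons, List.append_assoc, List.singleton_append] at h
  obtain ⟨rfl, -, rfl⟩ := (List.append_cons_inj_of_notMem h1 h2).mp h
  rfl

lemma TP_step [Fintype V] {R : V → V → Prop} (hf : ∀ x t, (TP R x t).Finite) (v t : V)
    (hvt : v ≠ t) :
    (TP R v t).ncard = ∑ u ∈ Finset.univ.filter (fun u => R v u), (TP R u t).ncard := by
  have e : TP R v t = ⋃ u ∈ Finset.univ.filter (fun u => R v u), (List.cons v) '' TP R u t := by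
    ext l
    simp only [Finset.mem_filter, Finset.mem_univ, true_and, Set.mem_iUnion, Set.mem_image]
    constructor
    · rintro ⟨h1, h2, h3⟩
      obtain ⟨c, rfl⟩ := List.head?_eq_some_iff.mp h1
      cases c with
      | nil => simp at h2; exact absurd h2 hvt
      | cons y c =>
        rw [List.isChain_cons_cons] at h3
        rw [List.getLast?_cons_cons] at h2
        exact ⟨y, h3.1, y :: c, ⟨rfl, h2, h3.2⟩, rfl⟩
    · rintro ⟨u, hu, c, ⟨h1, h2, h3⟩, rfl⟩
      obtain ⟨c, rfl⟩ := List.head?_eq_some_iff.mp h1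
      refine ⟨rfl, ?_, ?_⟩
      · rw [List.getLast?_cons_cons]; exact h2
      · rw [List.isChain_cons_cons]; exact ⟨hu, h3⟩
  have hinj : Function.Injective (List.cons v) := List.cons_injective
  have hd : ∀ u, ((List.cons v) '' TP R u t).ncard = (TP R u t).ncard := fun u =>
    Set.ncard_image_of_injective _ hinj
  have hc : ∀ A : Set (List V), ∀ h : A.Finite, A.ncard = h.toFinset.card :=
    fun A h => Set.ncard_eq_toFinset_card A h
  have e2 : (hf v t).toFinset = (Finset.univ.filter (fun u => R v u)).biUnion
      (fun u => ((hf u t).image (List.cons v)).toFinset) := by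
    ext l
    rw [Set.Finite.mem_toFinset, e]
    simp only [Set.mem_iUnion, Finset.mem_biUnion, Set.Finite.mem_toFinset, exists_prop]
  rw [hc _ (hf v t), e2, Finset.card_biUnion]
  · refine Finset.sum_congr rfl fun u _ => ?_
    rw [← hc, hd]
  · intro a _ b _ hab
    refine Finset.disjoint_left.mpr ?_
    intro l ha hb
    rw [Set.Finite.mem_toFinset] at ha hb
    obtain ⟨c, hc1, rfl⟩ := ha
    obtain ⟨c', hc2, h⟩ := hb
    obtain rfl := hinj h
    have := hc1.1.symm.trans hc2.1
    exact hab (Option.some.inj this)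

end Brandes

/-- Brandes' dependency recurrence: for a source `s` and any vertex `v ≠ s` in a finite
directed graph with positive edge weights in which every vertex is reachable from `s`,
`δ_{s⋆}(v) = Σ_{u : v ∈ P_s(u)} (σ_{sv}/σ_{su})·(1 + δ_{s⋆}(u))`, where `P_s(u)` is the
set of vertices `v` with `(v,u) ∈ E` and `d(s,v) + W(v,u) = d(s,u)`. -/
theorem stmt_13 {V : Type*} [Fintype V] [DecidableEq V] (E : V → V → Prop)
    (W : V → V → ℝ) (hW : ∀ u v, E u v → 0 < W u v) (s v : V) (hvs : v ≠ s)
    (hreach : ∀ t, ∃ l, IsPathList E s t l) :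
    dep E W s v =
      ∑ u ∈ Finset.univ.filter (fun u => E v u ∧ wdist E W s v + W v u = wdist E W s u),
        ((nsp E W s v : ℝ) / (nsp E W s u : ℝ)) * (1 + dep E W s u) := by
  set d := wdist E W s with hd
  set R := TightE E W d with hRdef
  have hR : ∀ x t l, l ∈ TP R x t → l.Nodup := fun x t l h => chain_nodup hW h.2.2
  have hf : ∀ x t, (TP R x t).Finite := fun x t => finite_nodup.subset (hR x t)
  have hn : ∀ t, nsp E W s t = (TP R s t).ncard := by
    intro t
    unfold nsp
    congr 1
    ext l
    exact shortest_iff hW hreach t l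
  have hnt : ∀ u t, nspThrough E W u s t = (TP R s u).ncard * (TP R u t).ncard := by
    intro u t
    rw [← TP_through hR]
    unfold nspThrough
    congr 1
    ext l
    simp only [Set.mem_setOf_eq]
    rw [← and_assoc, shortest_iff hW hreach t l]
  have hpos : ∀ t, ((TP R s t).ncard : ℝ) ≠ 0 := by
    intro t
    obtain ⟨l, hl⟩ := wdist_attained (W := W) (hreach t)
    rw [shortest_iff hW hreach t l] at hl
    have := (Set.ncard_pos (hf s t)).mpr ⟨l, hl⟩
    exact_mod_cast this.ne'
  have hzero : ∀ u t, d t < d u → (TP R u t).ncard = 0 := by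
    intro u t htu
    rw [Set.ncard_eq_zero (hf u t), Set.eq_empty_iff_forall_notMem]
    rintro l ⟨h1, h2, h3⟩
    have hp := chain_lt hW h3
    obtain ⟨c, rfl⟩ := List.head?_eq_some_iff.mp h1
    have hm := List.mem_of_getLast? h2
    rcases List.mem_cons.mp hm with rfl | hm
    · exact lt_irrefl _ htu
    · exact lt_asymm htu ((List.pairwise_cons.mp hp).1 t hm)
  have hs0 : d s = 0 := wdist_self s
  have hnn : ∀ t, 0 ≤ d t := by
    intro t
    obtain ⟨l, hl, h⟩ := wdist_attained (W := W) (hreach t)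
    rw [hd, ← h]
    exact pathCost_nonneg hW l hl.2.2.2
  have hdep : ∀ u, dep E W s u = (TP R s u).ncard *
      ∑ t ∈ (Finset.univ.erase s).erase u, ((TP R u t).ncard : ℝ) / (TP R s t).ncard := by
    intro u
    unfold dep
    rw [Finset.mul_sum]
    refine Finset.sum_congr rfl fun t _ => ?_
    rw [hn, hnt]
    push_cast
    ring
  have hflt : Finset.univ.filter (fun u => E v u ∧ d v + W v u = d u) =
      Finset.univ.filter (fun u => R v u) := by
    ext u
    simp [hRdef, TightE]
  rw [hflt, hdep v]
  have h1 : ∑ t ∈ (Finset.univ.erase s).erase v, ((TP R v t).ncard : ℝ) / (TP R s t).ncard =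
      ∑ u ∈ Finset.univ.filter (fun u => R v u), ∑ t ∈ (Finset.univ.erase s).erase v,
        ((TP R u t).ncard : ℝ) / (TP R s t).ncard := by
    rw [Finset.sum_comm]
    refine Finset.sum_congr rfl fun t ht => ?_
    rw [TP_step hf v t (Finset.ne_of_mem_erase ht).symm]
    push_cast
    rw [Finset.sum_div]
  rw [h1, Finset.mul_sum]
  refine Finset.sum_congr rfl fun u hu => ?_
  have hvu : R v u := (Finset.mem_filter.mp hu).2
  have hlt : d v < d u := by
    have := hW v u hvu.1
    have := hvu.2
    linarith
  have hus : u ≠ s := by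
    rintro rfl
    have := hnn v
    linarith
  have hsu : d s < d u := by
    have := hnn v
    linarith
  have h2 : ∑ t ∈ (Finset.univ.erase s).erase v, ((TP R u t).ncard : ℝ) / (TP R s t).ncard =
      ∑ t ∈ Finset.univ.erase s, ((TP R u t).ncard : ℝ) / (TP R s t).ncard := by
    refine Finset.sum_erase _ ?_
    rw [hzero u v hlt]
    simp
  have h3 := Finset.add_sum_erase (Finset.univ.erase s)
    (fun t => ((TP R u t).ncard : ℝ) / (TP R s t).ncard)
    (Finset.mem_erase.mpr ⟨hus, Finset.mem_univ u⟩)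
  rw [h2, ← h3, hdep u, TP_self hR u, hn, hn]
  have := hpos u
  field_simp
  push_cast
  ring
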